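/- Let K be a field of characteristic 0 and L the K-algebra generated by d, u, h subject to the relations dh = hd − d, hu = uh − u (i.e. r = 1, γ = 1), du = s·u·d (f = 0), where s ∈ K*. Every nonzero normal element of L is homogeneous with respect to the Z-grading with deg(u) = 1, deg(d) = −1, deg(h) = 0. -/

import Mathlib

/-- Defining relations of the generalized down-up algebra `L(0, 1, s, 1)`:
`dh = hd − d`, `hu = uh − u`, `du = s·ud`, with generators `0 ↦ d`, `1 ↦ u`,
`2 ↦ h`. -/
inductive GDURel (K : Type*) [CommRing K] (s : K) :
    FreeAlgebra K (Fin 3) → FreeAlgebra K (Fin 3) → Prop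
  | dh : GDURel K s (FreeAlgebra.ι K 0 * FreeAlgebra.ι K 2)
      (FreeAlgebra.ι K 2 * FreeAlgebra.ι K 0 - FreeAlgebra.ι K 0)
  | hu : GDURel K s (FreeAlgebra.ι K 2 * FreeAlgebra.ι K 1)
      (FreeAlgebra.ι K 1 * FreeAlgebra.ι K 2 - FreeAlgebra.ι K 1)
  | du : GDURel K s (FreeAlgebra.ι K 0 * FreeAlgebra.ι K 1)
      (algebraMap K (FreeAlgebra K (Fin 3)) s *
        (FreeAlgebra.ι K 1 * FreeAlgebra.ι K 0))

/-- The generalized down-up algebra `L(0, 1, s, 1)`. -/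
abbrev GDU (K : Type*) [CommRing K] (s : K) := RingQuot (GDURel K s)

noncomputable def GDU.d (K : Type*) [CommRing K] (s : K) : GDU K s :=
  RingQuot.mkAlgHom K (GDURel K s) (FreeAlgebra.ι K 0)

noncomputable def GDU.u (K : Type*) [CommRing K] (s : K) : GDU K s :=
  RingQuot.mkAlgHom K (GDURel K s) (FreeAlgebra.ι K 1)

noncomputable def GDU.h (K : Type*) [CommRing K] (s : K) : GDU K s :=
  RingQuot.mkAlgHom K (GDURel K s) (FreeAlgebra.ι K 2)

/-- The homogeneous component of degree `i ∈ ℤ` of `L(0, 1, s, 1)` with respect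
to the grading `deg u = 1`, `deg d = −1`, `deg h = 0`: the span of the monomials
`h^a (ud)^b u^i` (for `i ≥ 0`) resp. `h^a (ud)^b d^{-i}` (for `i < 0`). -/
noncomputable def GDU.component (K : Type*) [CommRing K] (s : K) (i : ℤ) :
    Submodule K (GDU K s) :=
  Submodule.span K {x : GDU K s | ∃ a b : ℕ,
    x = GDU.h K s ^ a * (GDU.u K s * GDU.d K s) ^ b *
      (if 0 ≤ i then GDU.u K s ^ i.toNat else GDU.d K s ^ (-i).toNat)}

namespace GDUProof

open GDU

section basic
variable {K : Type*} [Field K] (s : K)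

lemma dh : d K s * h K s = h K s * d K s - d K s := by
  have := RingQuot.mkAlgHom_rel K (GDURel.dh (K := K) (s := s))
  simpa [GDU.d, GDU.h, GDU.u] using this

lemma uh : u K s * h K s = h K s * u K s + u K s := by
  have := RingQuot.mkAlgHom_rel K (GDURel.hu (K := K) (s := s))
  simp only [map_mul, map_sub] at this
  simp [GDU.h, GDU.u, this]

lemma du : d K s * u K s = s • (u K s * d K s) := by
  have := RingQuot.mkAlgHom_rel K (GDURel.du (K := K) (s := s))
  simpa [GDU.d, GDU.h, GDU.u, Algebra.smul_def] using this

/-- `t = ud` -/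
noncomputable def t : GDU K s := u K s * d K s

lemma th : t s * h K s = h K s * t s := by
  unfold t
  rw [mul_assoc, dh, mul_sub, ← mul_assoc, uh]
  noncomm_ring

lemma ut (hs : s ≠ 0) : u K s * t s = s⁻¹ • (t s * u K s) := by
  unfold t
  rw [mul_assoc (u K s) (d K s), du, mul_smul_comm, smul_smul, inv_mul_cancel₀ hs, one_smul]

lemma dt : d K s * t s = s • (t s * d K s) := by
  unfold t
  rw [← mul_assoc, du, smul_mul_assoc]

/-- universal property -/
noncomputable def lft {B : Type*} [Ring B] [Algebra K B] (d' u' h' : B)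
    (h1 : d' * h' = h' * d' - d') (h2 : h' * u' = u' * h' - u') (h3 : d' * u' = s • (u' * d')) :
    GDU K s →ₐ[K] B :=
  RingQuot.liftAlgHom K ⟨FreeAlgebra.lift K ![d', u', h'], by
    intro x y hxy
    cases hxy
    · simpa using h1
    · simpa using h2
    · simpa [Algebra.smul_def] using h3⟩

section
variable {B : Type*} [Ring B] [Algebra K B] (d' u' h' : B)
    (h1 : d' * h' = h' * d' - d') (h2 : h' * u' = u' * h' - u') (h3 : d' * u' = s • (u' * d'))

@[simp] lemma lft_d : lft s d' u' h' h1 h2 h3 (d K s) = d' := by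
  simp [lft, GDU.d]
@[simp] lemma lft_u : lft s d' u' h' h1 h2 h3 (u K s) = u' := by
  simp [lft, GDU.u]
@[simp] lemma lft_h : lft s d' u' h' h1 h2 h3 (h K s) = h' := by
  simp [lft, GDU.h]
end

lemma ind (P : GDU K s → Prop) (hc : ∀ c : K, P (algebraMap K _ c)) (hd : P (d K s))
    (hu : P (u K s)) (hh : P (h K s)) (ha : ∀ x y, P x → P y → P (x + y))
    (hm : ∀ x y, P x → P y → P (x * y)) (x : GDU K s) : P x := by
  obtain ⟨a, rfl⟩ := RingQuot.mkAlgHom_surjective K (GDURel K s) x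
  induction a using FreeAlgebra.induction with
  | grade0 r => simpa using hc r
  | grade1 i =>
    fin_cases i
    · exact hd
    · exact hu
    · exact hh
  | mul a b iha ihb => rw [map_mul]; exact hm _ _ iha ihb
  | add a b iha ihb => rw [map_add]; exact ha _ _ iha ihb

/-- the basis element of degree i -/
noncomputable def U (i : ℤ) : GDU K s :=
  if 0 ≤ i then u K s ^ i.toNat else d K s ^ (-i).toNat

lemma comp_eq (i : ℤ) : component K s i =
    Submodule.span K {x | ∃ a b : ℕ, x = h K s ^ a * t s ^ b * U s i} := rfl

lemma mem_gen (i : ℤ) (a b : ℕ) : h K s ^ a * t s ^ b * U s i ∈ component K s i := by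
  rw [comp_eq]; exact Submodule.subset_span ⟨a, b, rfl⟩

lemma gen_ind {i : ℤ} {P : GDU K s → Prop} (h0 : P 0) (ha : ∀ x y, P x → P y → P (x + y))
    (hc : ∀ (c : K) x, P x → P (c • x)) (hg : ∀ a b : ℕ, P (h K s ^ a * t s ^ b * U s i))
    {x : GDU K s} (hx : x ∈ component K s i) : P x := by
  rw [comp_eq] at hx
  induction hx using Submodule.span_induction with
  | mem x hx => obtain ⟨a, b, rfl⟩ := hx; exact hg a b
  | zero => exact h0
  | add x y _ _ hx hy => exact ha x y hx hy
  | smul c x _ hx => exact hc c x hx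

lemma h_mul {i : ℤ} {x : GDU K s} (hx : x ∈ component K s i) : h K s * x ∈ component K s i := by
  refine gen_ind s (P := fun x => h K s * x ∈ component K s i) ?_ ?_ ?_ ?_ hx
  · simp
  · intro x y hx hy; rw [mul_add]; exact add_mem hx hy
  · intro c x hx; rw [mul_smul_comm]; exact Submodule.smul_mem _ _ hx
  · intro a b
    have := mem_gen s i (a + 1) b
    rwa [pow_succ', mul_assoc, mul_assoc, ← mul_assoc (h K s ^ a)] at this

lemma t_mul {i : ℤ} {x : GDU K s} (hx : x ∈ component K s i) : t s * x ∈ component K s i := by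
  refine gen_ind s (P := fun x => t s * x ∈ component K s i) ?_ ?_ ?_ ?_ hx
  · simp
  · intro x y hx hy; rw [mul_add]; exact add_mem hx hy
  · intro c x hx; rw [mul_smul_comm]; exact Submodule.smul_mem _ _ hx
  · intro a b
    have := mem_gen s i a (b + 1)
    have hc : Commute (t s) (h K s ^ a) := Commute.pow_right (th s) a
    rw [mul_assoc, ← mul_assoc, hc.eq, mul_assoc]
    rwa [pow_succ', mul_assoc, mul_assoc] at this

lemma U_mem (i : ℤ) : U s i ∈ component K s i := by
  simpa using mem_gen s i 0 0

lemma uU (i : ℤ) : u K s * U s i ∈ component K s (i + 1) := by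
  rcases le_or_gt 0 i with hi | hi
  · have : u K s * U s i = U s (i + 1) := by
      unfold U
      rw [if_pos hi, if_pos (by omega), ← pow_succ']
      congr 1; omega
    rw [this]; exact U_mem s _
  · have : u K s * U s i = t s * U s (i + 1) := by
      have e : (-i).toNat = (-(i+1)).toNat + 1 := by omega
      unfold U t
      rw [if_neg (by omega), e, pow_succ', mul_assoc]
      split_ifs with h
      · have : i = -1 := by omega
        subst this; simp
      · rfl
    rw [this]; exact t_mul s (U_mem s _)

lemma dU (i : ℤ) : d K s * U s i ∈ component K s (i - 1) := by
  rcases le_or_gt i 0 with hi | hi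
  · have : d K s * U s i = U s (i - 1) := by
      have e : (-(i-1)).toNat = (-i).toNat + 1 := by omega
      unfold U
      rw [if_neg (c := 0 ≤ i - 1) (by omega), e, pow_succ']
      split_ifs with h
      · have : i = 0 := by omega
        subst this; simp
      · rfl
    rw [this]; exact U_mem s _
  · have : d K s * U s i = s • (t s * U s (i - 1)) := by
      have e : i.toNat = (i - 1).toNat + 1 := by omega
      unfold U t
      rw [if_pos (by omega), if_pos (by omega), e, pow_succ', ← mul_assoc, du, smul_mul_assoc]
    rw [this]; exact Submodule.smul_mem _ _ (t_mul s (U_mem s _))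

lemma u_mul (hs : s ≠ 0) {i : ℤ} {x : GDU K s} (hx : x ∈ component K s i) :
    u K s * x ∈ component K s (i + 1) := by
  refine gen_ind s (P := fun x => u K s * x ∈ component K s (i + 1)) ?_ ?_ ?_ ?_ hx
  · simp
  · intro x y hx hy; rw [mul_add]; exact add_mem hx hy
  · intro c x hx; rw [mul_smul_comm]; exact Submodule.smul_mem _ _ hx
  · intro a b
    induction a with
    | zero =>
      induction b with
      | zero => simpa using uU s i
      | succ b ih =>
        have : u K s * (h K s ^ 0 * t s ^ (b + 1) * U s i) =
            s⁻¹ • (t s * (u K s * (h K s ^ 0 * t s ^ b * U s i))) := by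
          simp only [pow_zero, one_mul, pow_succ']
          rw [← mul_assoc, ← mul_assoc, ut s hs]
          simp only [smul_mul_assoc, mul_assoc]
        rw [this]
        exact Submodule.smul_mem _ _ (t_mul s ih)
    | succ a ih =>
      have : u K s * (h K s ^ (a + 1) * t s ^ b * U s i) =
          h K s * (u K s * (h K s ^ a * t s ^ b * U s i)) + u K s * (h K s ^ a * t s ^ b * U s i) := by
        rw [pow_succ', mul_assoc, mul_assoc, ← mul_assoc (u K s), uh, add_mul]
        simp only [mul_assoc]
      rw [this]
      exact add_mem (h_mul s ih) ih

lemma d_mul {i : ℤ} {x : GDU K s} (hx : x ∈ component K s i) :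
    d K s * x ∈ component K s (i - 1) := by
  refine gen_ind s (P := fun x => d K s * x ∈ component K s (i - 1)) ?_ ?_ ?_ ?_ hx
  · simp
  · intro x y hx hy; rw [mul_add]; exact add_mem hx hy
  · intro c x hx; rw [mul_smul_comm]; exact Submodule.smul_mem _ _ hx
  · intro a b
    induction a with
    | zero =>
      induction b with
      | zero => simpa using dU s i
      | succ b ih =>
        have : d K s * (h K s ^ 0 * t s ^ (b + 1) * U s i) =
            s • (t s * (d K s * (h K s ^ 0 * t s ^ b * U s i))) := by
          simp only [pow_zero, one_mul, pow_succ']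
          rw [← mul_assoc, ← mul_assoc, dt s]
          simp only [smul_mul_assoc, mul_assoc]
        rw [this]
        exact Submodule.smul_mem _ _ (t_mul s ih)
    | succ a ih =>
      have : d K s * (h K s ^ (a + 1) * t s ^ b * U s i) =
          h K s * (d K s * (h K s ^ a * t s ^ b * U s i)) - d K s * (h K s ^ a * t s ^ b * U s i) := by
        rw [pow_succ', mul_assoc, mul_assoc, ← mul_assoc (d K s), dh, sub_mul]
        simp only [mul_assoc]
      rw [this]
      exact sub_mem (h_mul s ih) ih

lemma upow_h (n : ℕ) : u K s ^ n * h K s = (h K s + (n : GDU K s)) * u K s ^ n := by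
  induction n with
  | zero => simp
  | succ n ih =>
    rw [pow_succ', mul_assoc, ih, ← mul_assoc, mul_add, uh, (Nat.cast_commute n (u K s)).symm.eq]
    push_cast
    noncomm_ring

lemma dpow_h (n : ℕ) : d K s ^ n * h K s = (h K s - (n : GDU K s)) * d K s ^ n := by
  induction n with
  | zero => simp
  | succ n ih =>
    rw [pow_succ', mul_assoc, ih, ← mul_assoc, mul_sub, dh, (Nat.cast_commute n (d K s)).symm.eq]
    push_cast
    simp only [sub_mul, add_mul, one_mul, mul_assoc]
    abel

lemma U_h (i : ℤ) : U s i * h K s = (h K s + (i : GDU K s)) * U s i := by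
  unfold U
  split_ifs with hi
  · rw [upow_h]
    congr 3
    rw [← Int.cast_natCast, Int.toNat_of_nonneg hi]
  · rw [dpow_h, sub_eq_add_neg]
    congr 3
    rw [← Int.cast_natCast, Int.toNat_of_nonneg (by omega)]; simp

lemma mul_h {i : ℤ} {x : GDU K s} (hx : x ∈ component K s i) :
    x * h K s = (h K s + (i : GDU K s)) * x := by
  refine gen_ind s (P := fun x => x * h K s = (h K s + (i : GDU K s)) * x) ?_ ?_ ?_ ?_ hx
  · simp
  · intro x y hx hy; rw [mul_add, add_mul, hx, hy]
  · intro c x hx; rw [mul_smul_comm, smul_mul_assoc, hx]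
  · intro a b
    rw [mul_assoc, U_h, ← mul_assoc, ← mul_assoc]
    congr 1
    have hc1 : Commute (h K s ^ a * t s ^ b) (h K s) :=
      ((Commute.refl _).pow_left a).mul_left (Commute.pow_left (th s) b)
    exact (hc1.add_right (Int.cast_commute i _).symm).eq

end basic

section rep
variable {K : Type*} [Field K] (s : K)

abbrev B (K : Type*) [Field K] := MvPolynomial (Fin 2) K

open MvPolynomial

noncomputable def sig : B K →ₐ[K] B K := aeval ![X 0 + 1, C s⁻¹ * X 1]
noncomputable def tau : B K →ₐ[K] B K := aeval ![X 0 - 1, C s * X 1]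

lemma tau_sig (hs : s ≠ 0) (p : B K) : tau s (sig s p) = p := by
  have : (tau s).comp (sig s) = AlgHom.id K (B K) := by
    ext i : 1
    fin_cases i
    · simp [tau, sig]
    · simp [tau, sig, ← mul_assoc, ← C_mul, hs, algHom_C]
  exact DFunLike.congr_fun this p

lemma sig_tau (hs : s ≠ 0) (p : B K) : sig s (tau s p) = p := by
  have : (sig s).comp (tau s) = AlgHom.id K (B K) := by
    ext i : 1
    fin_cases i
    · simp [tau, sig]
    · simp [tau, sig, ← mul_assoc, ← C_mul, hs, algHom_C]
  exact DFunLike.congr_fun this p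

noncomputable def rD : Module.End K (B K) := (tau s).toLinearMap * LinearMap.mulLeft K (X 1)
noncomputable def rU : Module.End K (B K) := (sig s).toLinearMap
noncomputable def rH : Module.End K (B K) := LinearMap.mulLeft K (X 0)

noncomputable def rho (hs : s ≠ 0) : GDU K s →ₐ[K] Module.End K (B K) :=
  lft s (rD s) (rU s) rH
    (by
      apply LinearMap.ext; intro p
      simp [rD, rH, tau]; ring)
    (by
      apply LinearMap.ext; intro p
      simp [rU, rH, sig]; ring)
    (by
      apply LinearMap.ext; intro p
      simp only [rU, rD, Module.End.mul_apply, LinearMap.smul_apply, AlgHom.toLinearMap_apply,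
        LinearMap.mulLeft_apply, map_mul, tau_sig s hs, sig_tau s hs]
      simp [sig, tau, smul_eq_C_mul]
      simp [← mul_assoc, ← C_mul, hs])

lemma rho_t (hs : s ≠ 0) : rho s hs (t s) = LinearMap.mulLeft K (X 1) := by
  apply LinearMap.ext; intro p
  simp only [t, rho, map_mul, lft_u, lft_d]
  simp [rU, rD, -map_mul, sig_tau s hs]

lemma rho_h (hs : s ≠ 0) : rho s hs (h K s) = LinearMap.mulLeft K (X 0) := by
  simp [rho, rH]

lemma rho_U_inj (hs : s ≠ 0) (i : ℤ) : Function.Injective (rho s hs (U s i)) := by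
  unfold U
  split_ifs
  · rw [map_pow, Module.End.coe_pow]
    apply Function.Injective.iterate
    simp only [rho, lft_u, rU]
    exact Function.LeftInverse.injective (g := tau s) (tau_sig s hs)
  · rw [map_pow, Module.End.coe_pow]
    apply Function.Injective.iterate
    simp only [rho, lft_d, rD, Module.End.coe_mul]
    refine Function.Injective.comp
      (Function.LeftInverse.injective (g := sig s) (sig_tau s hs)) ?_
    intro p q hpq
    exact mul_left_cancel₀ (X_ne_zero 1) hpq

/-- linear map `p ↦ p(h,t) U_i` -/
noncomputable def theta (i : ℤ) : B K →ₗ[K] GDU K s :=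
  (basisMonomials (Fin 2) K).constr K (fun m => h K s ^ (m 0) * t s ^ (m 1) * U s i)

lemma theta_mon (i : ℤ) (m : Fin 2 →₀ ℕ) :
    theta s i (monomial m 1) = h K s ^ (m 0) * t s ^ (m 1) * U s i := by
  have := (basisMonomials (Fin 2) K).constr_basis K
    (fun m => h K s ^ (m 0) * t s ^ (m 1) * U s i) m
  simpa [theta] using this

lemma mem_theta {i : ℤ} {x : GDU K s} (hx : x ∈ component K s i) : ∃ p, theta s i p = x := by
  refine gen_ind s (P := fun x => ∃ p, theta s i p = x) ⟨0, map_zero _⟩ ?_ ?_ ?_ hx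
  · rintro _ _ ⟨p, rfl⟩ ⟨q, rfl⟩; exact ⟨p + q, map_add _ _ _⟩
  · rintro c _ ⟨p, rfl⟩; exact ⟨c • p, map_smul _ _ _⟩
  · intro a b
    refine ⟨monomial (Finsupp.single 0 a + Finsupp.single 1 b) 1, ?_⟩
    rw [theta_mon]; simp

lemma rho_theta (hs : s ≠ 0) (i : ℤ) (p q : B K) :
    rho s hs (theta s i p) q = p * rho s hs (U s i) q := by
  induction p using MvPolynomial.induction_on' with
  | monomial m c =>
    have e : (monomial m c : B K) = c • monomial m 1 := by simp [smul_monomial]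
    have e2 : (monomial m 1 : B K) = X 0 ^ (m 0) * X 1 ^ (m 1) := by
      rw [monomial_eq, Finsupp.prod_fintype _ _ (by simp)]; simp
    rw [e, map_smul, theta_mon, map_smul, map_mul, map_mul, map_pow, map_pow, rho_t, rho_h,
      LinearMap.pow_mulLeft, LinearMap.pow_mulLeft, e2]
    simp [mul_assoc]
  | add p q hp hq => rw [map_add, map_add, LinearMap.add_apply, hp, hq, add_mul]

lemma hom_domain (hs : s ≠ 0) {i j : ℤ} {x y : GDU K s} (hx : x ∈ component K s i)
    (hy : y ∈ component K s j) (hxy : x * y = 0) : x = 0 ∨ y = 0 := by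
  obtain ⟨p, rfl⟩ := mem_theta s hx
  obtain ⟨q, rfl⟩ := mem_theta s hy
  have h1 := congrArg (fun z => rho s hs z 1) hxy
  simp only [map_mul, Module.End.mul_apply, rho_theta, map_zero, LinearMap.zero_apply] at h1
  rcases mul_eq_zero.1 h1 with h1 | h1
  · left; simp [h1]
  · right
    rw [map_eq_zero_iff _ (rho_U_inj s hs i)] at h1
    rcases mul_eq_zero.1 h1 with h1 | h1
    · simp [h1]
    · rw [map_eq_zero_iff _ (rho_U_inj s hs j)] at h1
      exact absurd h1 one_ne_zero
end rep

section grading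
variable {K : Type*} [Field K] (s : K)
open AddMonoidAlgebra

abbrev T := AddMonoidAlgebra (GDU K s) ℤ

noncomputable def Phi : GDU K s →ₐ[K] T s :=
  lft s (single (-1) (d K s)) (single 1 (u K s)) (single 0 (h K s))
    (by rw [single_mul_single, single_mul_single, dh, single_sub]; simp)
    (by rw [single_mul_single, single_mul_single, uh, add_zero, zero_add, ← single_sub]; simp)
    (by rw [single_mul_single, single_mul_single, du, smul_single]; simp)

lemma Phi_coeff (hs : s ≠ 0) (x : GDU K s) (i : ℤ) : (Phi s x).coeff i ∈ component K s i := by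
  have key : ∀ (x : GDU K s) (F : T s), (∀ i, F.coeff i ∈ component K s i) →
      ∀ i, (Phi s x * F).coeff i ∈ component K s i := by
    intro x
    induction x using ind s with
    | hc c =>
      intro F hF i
      rw [AlgHom.commutes, ← Algebra.smul_def, coeff_smul_apply]
      exact Submodule.smul_mem _ _ (hF i)
    | hd =>
      intro F hF i
      rw [Phi, lft_d, coeff_single_mul_eq_mul_coeff (i + 1) (by intros; omega)]
      simpa using d_mul s (hF (i + 1))
    | hu =>
      intro F hF i
      rw [Phi, lft_u, coeff_single_mul_eq_mul_coeff (i - 1) (by intros; omega)]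
      simpa using u_mul s hs (hF (i - 1))
    | hh =>
      intro F hF i
      rw [Phi, lft_h, coeff_single_zero_mul]
      exact h_mul s (hF i)
    | ha x y hx hy =>
      intro F hF i
      rw [map_add, add_mul, coeff_add]
      exact add_mem (hx F hF i) (hy F hF i)
    | hm x y hx hy =>
      intro F hF
      rw [map_mul, mul_assoc]
      exact hx _ (hy F hF)
  have h1 := key x 1 (by
    intro i
    rw [one_def, coeff_single_apply]
    split_ifs with h
    · subst h; simpa [U] using U_mem s 0
    · exact zero_mem _) i
  rwa [mul_one] at h1

noncomputable def eps : T s →ₐ[K] GDU K s :=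
  liftNCAlgHom (AlgHom.id K _) 1 (fun _ _ => Commute.one_right _)

lemma eps_single (i : ℤ) (x : GDU K s) : eps s (single i x) = x := by
  have := AddMonoidAlgebra.liftNC_single ((AlgHom.id K (GDU K s) : GDU K s →+* GDU K s) : GDU K s →+ GDU K s)
    (1 : Multiplicative ℤ →* GDU K s) i x
  exact this.trans (by simp)

lemma eps_Phi (x : GDU K s) : eps s (Phi s x) = x := by
  induction x using ind s with
  | hc c => rw [AlgHom.commutes, AlgHom.commutes]
  | hd => rw [Phi, lft_d, eps_single]
  | hu => rw [Phi, lft_u, eps_single]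
  | hh => rw [Phi, lft_h, eps_single]
  | ha x y hx hy => rw [map_add, map_add, hx, hy]
  | hm x y hx hy => rw [map_mul, map_mul, hx, hy]

lemma main [CharZero K] (hs : s ≠ 0) (ν y : GDU K s) (hν : ν ≠ 0) (hy : ν * h K s = y * ν) :
    ∃ i : ℤ, ν ∈ component K s i := by
  have hF0 : Phi s ν ≠ 0 := fun h0 => hν (by rw [← eps_Phi s ν, h0, map_zero])
  have hE := congrArg (Phi s) hy
  rw [map_mul, map_mul] at hE
  rw [show Phi s (h K s) = single 0 (h K s) by simp [Phi]] at hE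
  have hFc := Phi_coeff s hs ν
  have hGc := Phi_coeff s hs y
  generalize hFd : Phi s ν = F at *
  generalize Phi s y = G at *
  have hFs : F.coeff.support.Nonempty := by
    rw [Finsupp.support_nonempty_iff]; simpa using hF0
  have hco : ∀ n, F.coeff n * h K s = (G * F).coeff n := by
    intro n; rw [← hE, coeff_mul_single_zero]
  -- extreme coefficient argument
  have ext1 : ∀ k ∈ G.coeff.support, ∀ m ∈ F.coeff.support,
      UniqueAdd G.coeff.support F.coeff.support k m → k + m ∈ F.coeff.support := by
    intro k hk m hm hu
    rw [Finsupp.mem_support_iff] at *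
    intro h0
    have := hco (k + m)
    rw [coeff_mul_add_of_uniqueAdd hu, h0, zero_mul] at this
    rcases hom_domain s hs (hGc k) (hFc m) this.symm with h | h
    · exact hk h
    · exact hm h
  have hG0 : ∀ k ∈ G.coeff.support, k = 0 := by
    intro k hk
    have hGs : G.coeff.support.Nonempty := ⟨k, hk⟩
    have hle : k ≤ 0 := by
      have h1 := ext1 _ (Finset.max'_mem _ hGs) _ (Finset.max'_mem _ hFs) (by
        intro a b ha hb hab
        have := Finset.le_max' _ _ ha
        have := Finset.le_max' _ _ hb
        omega)
      have := Finset.le_max' _ _ h1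
      have := Finset.le_max' _ _ hk
      omega
    have hge : 0 ≤ k := by
      have h1 := ext1 _ (Finset.min'_mem _ hGs) _ (Finset.min'_mem _ hFs) (by
        intro a b ha hb hab
        have := Finset.min'_le _ _ ha
        have := Finset.min'_le _ _ hb
        omega)
      have := Finset.min'_le _ _ h1
      have := Finset.min'_le _ _ hk
      omega
    omega
  have hG : G = single 0 (G.coeff 0) := by
    ext k
    rw [coeff_single_apply]
    split_ifs with h
    · rw [h]
    · by_contra hk
      exact h (hG0 k (Finsupp.mem_support_iff.2 hk)).symm
  have hy0 : ∀ n ∈ F.coeff.support, G.coeff 0 = h K s + (n : GDU K s) := by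
    intro n hn
    have h1 := hco n
    rw [hG, coeff_single_zero_mul, mul_h s (hFc n)] at h1
    have hmem : h K s + (n : GDU K s) - G.coeff 0 ∈ component K s 0 := by
      have hone : (1 : GDU K s) ∈ component K s 0 := by simpa [U] using U_mem s 0
      refine sub_mem (add_mem ?_ ?_) (hGc 0)
      · simpa using h_mul s hone
      · simpa using zsmul_mem hone n
    rcases hom_domain s hs hmem (hFc n) (by rw [sub_mul, h1, sub_self]) with h | h
    · exact (sub_eq_zero.1 h).symm
    · exact absurd h (Finsupp.mem_support_iff.1 hn)
  obtain ⟨i, hi⟩ := hFs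
  have : Nontrivial (GDU K s) := ⟨ν, 0, hν⟩
  have : CharZero (GDU K s) := charZero_of_injective_algebraMap (algebraMap K (GDU K s)).injective
  have hF : F = single i (F.coeff i) := by
    ext k
    rw [coeff_single_apply]
    split_ifs with h
    · rw [h]
    · by_contra hk
      have := (hy0 k (Finsupp.mem_support_iff.2 hk)).symm.trans (hy0 i hi)
      exact h (Int.cast_injective (add_left_cancel this)).symm
  refine ⟨i, ?_⟩
  rw [← eps_Phi s ν, hFd, hF, eps_single]
  exact hFc i

end grading

end GDUProof

/-- Every nonzero normal element of `L(0, 1, s, 1)` is homogeneous with respect to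
the `ℤ`-grading with `deg u = 1`, `deg d = −1`, `deg h = 0`. -/
theorem gdu_normal_is_homogeneous {K : Type*} [Field K] [CharZero K]
    (s : K) (hs : s ≠ 0) (ν : GDU K s) (hν : ν ≠ 0)
    (h1 : ∀ x : GDU K s, ∃ y : GDU K s, ν * x = y * ν)
    (h2 : ∀ x : GDU K s, ∃ y : GDU K s, x * ν = ν * y) :
    ∃ i : ℤ, ν ∈ GDU.component K s i := by
  obtain ⟨y, hy⟩ := h1 (GDU.h K s)
  exact GDUProof.main s hs ν y hν hy
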